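/- Let X and Y be real Banach spaces and F : ℝ × X → Y a C¹ map satisfying: (1) for every (λ,u) ∈ ℝ × X the partial derivative D_u F(λ,u) : X → Y is a Fredholm operator of index 0; (2) F is proper on every closed bounded subset of ℝ × X; (3) u = u₀ is the unique solution of F(λ₀,u) = 0; (4) D_u F(λ₀,u₀) : X → Y is bijective. Suppose moreover that there does not exist an unbounded closed connected subset of S containing the point (λ₀,u₀). Then there exists a bounded open subset U of ℝ × X containing C⁺ ∪ C⁻ such that ∂U ∩ S = ∅. -/

import Mathlib

open Set Bornology

/-- A bounded linear operator between real normed spaces is Fredholm of index `0`: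
its kernel is finite dimensional, its range is closed, and the dimension of the kernel
equals the (finite) codimension of the range. -/
def IsFredholmIndexZero {X Y : Type*} [NormedAddCommGroup X] [NormedSpace ℝ X]
    [NormedAddCommGroup Y] [NormedSpace ℝ Y] (T : X →L[ℝ] Y) : Prop :=
  FiniteDimensional ℝ (LinearMap.ker (T : X →ₗ[ℝ] Y)) ∧
  IsClosed (LinearMap.range (T : X →ₗ[ℝ] Y) : Set Y) ∧
  FiniteDimensional ℝ (Y ⧸ LinearMap.range (T : X →ₗ[ℝ] Y)) ∧
  Module.finrank ℝ (LinearMap.ker (T : X →ₗ[ℝ] Y)) = Module.finrank ℝ (Y ⧸ LinearMap.range (T : X →ₗ[ℝ] Y))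

open Metric in
/-- In a metric space, let `S` be a closed set whose intersections with closed balls around `p ∈ S`
are compact. If the connected component of `p` in `S` is bounded, then it has a bounded open
neighborhood whose boundary avoids `S`. -/
theorem exists_isOpen_isBounded_frontier_inter_eq_empty {E : Type*} [MetricSpace E] {S : Set E}
    {p : E} (hS : IsClosed S) (hp : p ∈ S) (hK : ∀ r, IsCompact (S ∩ closedBall p r))
    (hC : IsBounded (connectedComponentIn S p)) :
    ∃ U : Set E, IsOpen U ∧ IsBounded U ∧ connectedComponentIn S p ⊆ U ∧ frontier U ∩ S = ∅ := by
  obtain ⟨R, hR, hCR⟩ := hC.subset_ball_lt 0 p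
  set K := S ∩ closedBall p R
  have hpK : p ∈ K := ⟨hp, mem_closedBall_self hR.le⟩
  have : CompactSpace K := isCompact_iff_compactSpace.mp (hK R)
  have hCK : connectedComponentIn S p ⊆ connectedComponentIn K p :=
    isPreconnected_connectedComponentIn.subset_connectedComponentIn (mem_connectedComponentIn hp)
      (subset_inter (connectedComponentIn_subset _ _) (hCR.trans ball_subset_closedBall))
  have hKC : connectedComponentIn K p ⊆ connectedComponentIn S p :=
    connectedComponentIn_mono p inter_subset_left
  let T : Set K := {x | (x : E) ∉ ball p R}
  have hT : IsCompact T := (isOpen_ball.isClosed_compl.preimage continuous_subtype_val).isCompact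
  -- A clopen subset of `K` that contains `p` and stays in the open ball.
  obtain ⟨W, hW, hpW, hWT⟩ : ∃ W : Set K, IsClopen W ∧ connectedComponent ⟨p, hpK⟩ ⊆ W ∧
      T ∩ W = ∅ := by
    obtain ⟨t, ht⟩ := hT.elim_finite_subfamily_closed
      (fun s : { s : Set K // IsClopen s ∧ (⟨p, hpK⟩ : K) ∈ s } => s.1) (fun s => s.2.1.1) (by
        rw [← connectedComponent_eq_iInter_isClopen]
        refine eq_empty_of_forall_notMem fun x ⟨hxT, hx⟩ => hxT (hCR (hKC ?_))
        rw [connectedComponentIn_eq_image hpK]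
        exact mem_image_of_mem _ hx)
    refine ⟨⋂ i ∈ t, i.1, isClopen_biInter_finset fun i _ => i.2.1, ?_, ht⟩
    exact subset_iInter₂ fun i _ => i.2.1.connectedComponent_subset i.2.2
  let Z : Set E := (↑) '' W
  have hZball : Z ⊆ ball p R := by
    rintro _ ⟨x, hx, rfl⟩
    by_contra h
    exact (hWT ▸ (⟨h, hx⟩ : x ∈ T ∩ W) : x ∈ (∅ : Set K))
  have hZ : IsClosed Z := (hW.1.isCompact.image continuous_subtype_val).isClosed
  have hZ' : IsClosed (((↑) : K → E) '' Wᶜ) :=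
    (hW.2.isClosed_compl.isCompact.image continuous_subtype_val).isClosed
  have hrest : S \ Z = (↑) '' Wᶜ ∪ S \ ball p R := by
    ext x
    constructor
    · rintro ⟨hxS, hxZ⟩
      by_cases hx : x ∈ ball p R
      · exact .inl ⟨⟨x, hxS, ball_subset_closedBall hx⟩, fun h => hxZ ⟨_, h, rfl⟩, rfl⟩
      · exact .inr ⟨hxS, hx⟩
    · rintro (⟨x, hx, rfl⟩ | ⟨hxS, hx⟩)
      · exact ⟨x.2.1, fun ⟨y, hy, hyx⟩ => hx (Subtype.ext hyx ▸ hy)⟩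
      · exact ⟨hxS, fun h => hx (hZball h)⟩
  have hrestClosed : IsClosed (S \ Z) := by
    rw [hrest]
    exact hZ'.union (hS.sdiff isOpen_ball)
  obtain ⟨U, V, hU, hV, hZU, hSV, hUV⟩ := normal_separation hZ hrestClosed disjoint_sdiff_right
  have hZUB : Z ⊆ U ∩ ball p R := subset_inter hZU hZball
  refine ⟨U ∩ ball p R, hU.inter isOpen_ball, isBounded_ball.subset inter_subset_right, ?_, ?_⟩
  · refine hCK.trans (Subset.trans ?_ hZUB)
    rw [connectedComponentIn_eq_image hpK]
    exact image_mono hpW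
  · refine eq_empty_of_forall_notMem fun x ⟨hx, hxS⟩ => ?_
    rw [(hU.inter isOpen_ball).frontier_eq] at hx
    exact (hUV.closure_left hV).notMem_of_mem_left (closure_mono inter_subset_left hx.1)
      (hSV ⟨hxS, fun h => hx.2 (hZUB h)⟩)

/-- Lemma 2: if no unbounded closed connected subset of `S` contains `(l₀, u₀)`, then
`C⁺ ∪ C⁻` is contained in a bounded open set whose boundary avoids `S`. -/
theorem bounded_isolating_neighborhood {X Y : Type*}
    [NormedAddCommGroup X] [NormedSpace ℝ X] [CompleteSpace X]
    [NormedAddCommGroup Y] [NormedSpace ℝ Y] [CompleteSpace Y]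
    (F : ℝ × X → Y) (hF : ContDiff ℝ 1 F)
    (l₀ : ℝ) (u₀ : X)
    (hFred : ∀ l : ℝ, ∀ u : X, IsFredholmIndexZero (fderiv ℝ (fun v => F (l, v)) u))
    (hProper : ∀ B : Set (ℝ × X), IsClosed B → IsBounded B → ∀ K : Set Y, IsCompact K →
      IsCompact (B ∩ F ⁻¹' K))
    (hUnique : ∀ u : X, F (l₀, u) = 0 ↔ u = u₀)
    (hBij : Function.Bijective (fderiv ℝ (fun v => F (l₀, v)) u₀))
    (S : Set (ℝ × X))
    (hS : S = closure {p : ℝ × X | F p = 0 ∧ p ≠ (l₀, u₀)} ∪ {(l₀, u₀)})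
    (hNoUnbounded : ¬ ∃ C : Set (ℝ × X), C ⊆ S ∧ IsClosed C ∧ IsConnected C ∧
      (l₀, u₀) ∈ C ∧ ¬ IsBounded C) :
    let Cp : Set (ℝ × X) :=
      connectedComponentIn (S ∩ (Set.Ici l₀ ×ˢ (Set.univ : Set X))) (l₀, u₀)
    let Cm : Set (ℝ × X) :=
      connectedComponentIn (S ∩ (Set.Iic l₀ ×ˢ (Set.univ : Set X))) (l₀, u₀)
    ∃ U : Set (ℝ × X), IsOpen U ∧ IsBounded U ∧ Cp ∪ Cm ⊆ U ∧ frontier U ∩ S = ∅ := by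
  intro Cp Cm
  have hp : (l₀, u₀) ∈ S := hS ▸ .inr rfl
  have hSclosed : IsClosed S := hS ▸ isClosed_closure.union isClosed_singleton
  have hSzero : S ⊆ F ⁻¹' {0} := by
    rw [hS]
    refine union_subset (closure_minimal (fun p h => h.1)
      (isClosed_singleton.preimage hF.continuous)) ?_
    rintro _ rfl
    exact (hUnique u₀).2 rfl
  have hcompact : ∀ r, IsCompact (S ∩ Metric.closedBall (l₀, u₀) r) := fun r => by
    have h := hProper _ (hSclosed.inter (Metric.isClosed_closedBall (x := (l₀, u₀)) (ε := r)))
      (Metric.isBounded_closedBall.subset inter_subset_right) {0} isCompact_singleton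
    rwa [inter_eq_left.2 (inter_subset_left.trans hSzero)] at h
  have hbounded : IsBounded (connectedComponentIn S (l₀, u₀)) := by
    by_contra h
    exact hNoUnbounded ⟨closure (connectedComponentIn S (l₀, u₀)),
      closure_minimal (connectedComponentIn_subset _ _) hSclosed, isClosed_closure,
      (isConnected_connectedComponentIn_iff.2 hp).closure,
      subset_closure (mem_connectedComponentIn hp), fun hb => h (hb.subset subset_closure)⟩
  obtain ⟨U, hU, hUb, hCU, hUS⟩ :=
    exists_isOpen_isBounded_frontier_inter_eq_empty hSclosed hp hcompact hbounded
  exact ⟨U, hU, hUb, (union_subset (connectedComponentIn_mono _ inter_subset_left)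
    (connectedComponentIn_mono _ inter_subset_left)).trans hCU, hUS⟩
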